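/- arXiv:2001.02546 — 2 statements merged into one kernel-verified Lean document; each statement's English description precedes it below -/
import Mathlib

section
/- Let α > 0 and H₀ ≥ e be real numbers and define f : ℝ → ℝ by f(x) = x·(log(x + H₀))^α (real power). Then for every x ≥ 0, x·f''(x) ≤ 2α·f'(x), where f' and f'' denote the first and second derivatives of f. -/
theorem hasDerivAt_log_add_rpow (p H x : ℝ) (hx : 1 < x + H) :
    HasDerivAt (fun x => Real.log (x + H) ^ p)
      (p * Real.log (x + H) ^ (p - 1) / (x + H)) x := by
  have hlog : HasDerivAt (fun x => Real.log (x + H)) (1 / (x + H)) x :=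
    ((hasDerivAt_id' x).add_const H).log (by linarith)
  refine (hlog.rpow_const (p := p) (Or.inl (Real.log_pos hx).ne')).congr_deriv ?_
  ring

theorem hasDerivAt_mul_log_add_rpow (p H x : ℝ) (hx : 1 < x + H) :
    HasDerivAt (fun x => x * Real.log (x + H) ^ p)
      (Real.log (x + H) ^ p + p * (x * Real.log (x + H) ^ (p - 1)) / (x + H)) x := by
  refine ((hasDerivAt_id' x).mul (hasDerivAt_log_add_rpow p H x hx)).congr_deriv ?_
  ring

theorem stmt_5 (α H₀ : ℝ) (hα : 0 < α) (hH₀ : Real.exp 1 ≤ H₀)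
    (f : ℝ → ℝ) (hf : f = fun x => x * Real.log (x + H₀) ^ α) :
    ∀ x : ℝ, 0 ≤ x → x * deriv (deriv f) x ≤ 2 * α * deriv f x := by
  intro x hx
  have he : 1 < Real.exp 1 := Real.one_lt_exp_iff.2 one_pos
  have hy : 1 < x + H₀ := by linarith
  have hy0 : 0 < x + H₀ := by linarith
  have hL : 1 ≤ Real.log (x + H₀) := (Real.le_log_iff_exp_le hy0).2 (by linarith)
  have hderiv : deriv f =ᶠ[nhds x] fun z => Real.log (z + H₀) ^ α +
      α * (z * Real.log (z + H₀) ^ (α - 1)) / (z + H₀) := by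
    filter_upwards [lt_mem_nhds (show 1 - H₀ < x by linarith)] with z hz
    rw [hf]
    exact (hasDerivAt_mul_log_add_rpow α H₀ z (by linarith)).deriv
  have hsecond := (hasDerivAt_log_add_rpow α H₀ x hy).add
    ((((hasDerivAt_mul_log_add_rpow (α - 1) H₀ x hy).const_mul α).div
      ((hasDerivAt_id' x).add_const H₀) hy0.ne'))
  rw [(hsecond.congr_of_eventuallyEq hderiv).deriv, hderiv.eq_of_nhds]
  have hLpos : 0 < Real.log (x + H₀) := by linarith
  have h1 : Real.log (x + H₀) ^ (α - 1) =
      Real.log (x + H₀) ^ (α - 1 - 1) * Real.log (x + H₀) := by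
    rw [← Real.rpow_add_one hLpos.ne']
    ring_nf
  have h2 : Real.log (x + H₀) ^ α =
      Real.log (x + H₀) ^ (α - 1) * Real.log (x + H₀) := by
    rw [← Real.rpow_add_one hLpos.ne']
    ring_nf
  have hP : 0 < Real.log (x + H₀) ^ (α - 1 - 1) := Real.rpow_pos_of_pos hLpos _
  rw [h2, h1]
  generalize Real.log (x + H₀) ^ (α - 1 - 1) = P at *
  generalize Real.log (x + H₀) = L at *
  obtain ⟨t, ht⟩ : ∃ t, t = x / (x + H₀) := ⟨_, rfl⟩
  have ht0 : 0 ≤ t := ht ▸ div_nonneg hx hy0.le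
  have ht1 : t ≤ 1 := ht ▸ (div_le_one hy0).2 (by linarith)
  have hkey : 0 ≤ 2 * L * (L - t) + α * t * (2 * L - t) + t ^ 2 + t ^ 2 * L := by
    have h3 : 0 ≤ L - t := by linarith
    have h4 : 0 ≤ 2 * L - t := by linarith
    positivity
  have hprod := mul_nonneg (mul_pos hα hP).le hkey
  rw [← sub_nonneg]
  refine hprod.trans_eq ?_
  rw [ht]
  field_simp
  ring
end

section
/- Let n ≥ 2 be an integer and α > 0 a real number. There exist constants C and ε with 0 < C < 1/n^n and 0 < ε ≤ 1/n such that every λ : Fin n → ℝ with λ i > 0 for all i and (∏ i, λ i)/(∑ i, λ i)^n ≥ C satisfies, for every index k: (i) λ k ≥ ε·(∑ i, λ i), and (ii) |1/(λ k) − n/(∑ i, λ i)| ≤ ε²/(8·α·(∑ i, λ i)). -/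
lemma mul_exp_one_sub_le_one (x : ℝ) : x * Real.exp (1 - x) ≤ 1 := by
  have h := Real.add_one_le_exp (x - 1)
  calc x * Real.exp (1 - x) ≤ Real.exp (x - 1) * Real.exp (1 - x) := by
        gcongr; linarith
    _ = 1 := by rw [← Real.exp_add]; simp

lemma sq_mul_exp_one_sub_le {x : ℝ} (hx : 0 < x) :
    (1 + x) ^ 2 * Real.exp (1 - x) ≤ 4 := by
  have h := mul_exp_one_sub_le_one ((1 + x) / 2)
  have hsq : Real.exp (1 - x) = Real.exp (1 - (1 + x) / 2) ^ 2 := by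
    rw [← Real.exp_nat_mul]; congr 1; push_cast; ring
  have h0 : 0 ≤ (1 + x) / 2 * Real.exp (1 - (1 + x) / 2) := by positivity
  rw [hsq]
  nlinarith

lemma prod_le_mul_exp_one_sub {ι : Type*} [Fintype ι] {x : ι → ℝ} (hx : ∀ i, 0 < x i)
    (hsum : ∑ i, x i = Fintype.card ι) (k : ι) :
    ∏ i, x i ≤ x k * Real.exp (1 - x k) := by
  classical
  have hprod : ∏ i, x i = ∏ i, x i * Real.exp (1 - x i) := by
    rw [Finset.prod_mul_distrib, ← Real.exp_sum]
    simp [hsum]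
  rw [hprod, ← Finset.mul_prod_erase _ _ (Finset.mem_univ k)]
  have hk := hx k
  refine mul_le_of_le_one_right (by positivity) (Finset.prod_le_one (fun i _ => ?_) fun i _ => ?_)
  · have := hx i
    positivity
  · exact mul_exp_one_sub_le_one _

/-- Quantitative stability of the AM-GM inequality for positive reals of mean one. -/
lemma abs_sub_one_le_of_le_prod {ι : Type*} [Fintype ι] {x : ι → ℝ} (hx : ∀ i, 0 < x i)
    (hsum : ∑ i, x i = Fintype.card ι) {δ : ℝ} (hδ : 0 ≤ δ)
    (hprod : 1 - (δ / (Fintype.card ι + 1)) ^ 2 ≤ ∏ i, x i) (k : ι) :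
    |x k - 1| ≤ δ := by
  have hk := hx k
  have hkn : x k ≤ Fintype.card ι :=
    hsum ▸ Finset.single_le_sum (fun i _ => (hx i).le) (Finset.mem_univ k)
  have h₁ := hprod.trans (prod_le_mul_exp_one_sub hx hsum k)
  have h₂ := mul_le_mul_of_nonneg_left h₁ (sq_nonneg (1 + x k))
  have h₃ := mul_le_mul_of_nonneg_left (sq_mul_exp_one_sub_le hk) hk.le
  have h₄ : (x k - 1) ^ 2 ≤ ((1 + x k) * (δ / (Fintype.card ι + 1))) ^ 2 := by
    nlinarith
  have h₅ : (1 + x k) * (δ / (Fintype.card ι + 1)) ≤ δ := by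
    rw [← mul_div_assoc, div_le_iff₀ (by positivity)]
    nlinarith
  exact (abs_le_of_sq_le_sq h₄ (by positivity)).trans h₅

theorem stmt_11 (n : ℕ) (hn : 2 ≤ n) (α : ℝ) (hα : 0 < α) :
    ∃ C ε : ℝ, 0 < C ∧ C < 1 / (n : ℝ) ^ n ∧ 0 < ε ∧ ε ≤ 1 / n ∧
      ∀ l : Fin n → ℝ, (∀ i, 0 < l i) →
        C ≤ (∏ i, l i) / (∑ i, l i) ^ n →
        ∀ k, ε * ∑ i, l i ≤ l k ∧
          |1 / l k - n / ∑ i, l i| ≤ ε ^ 2 / (8 * α * ∑ i, l i) := by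
  have hn0 : (0 : ℝ) < n := by positivity
  obtain ⟨ε, hε⟩ : ∃ ε : ℝ, ε = 1 / (2 * n) := ⟨_, rfl⟩
  have hε0 : 0 < ε := by rw [hε]; positivity
  obtain ⟨δ, hδ0, hδ_half, hδ⟩ : ∃ δ : ℝ, 0 < δ ∧ δ ≤ 1 / 2 ∧ δ ≤ ε ^ 2 / (16 * n * α) :=
    ⟨min (1 / 2) (ε ^ 2 / (16 * n * α)), by positivity, min_le_left _ _, min_le_right _ _⟩
  have hq0 : 0 < δ / (n + 1) := by positivity
  have hq1 : δ / (n + 1) < 1 := by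
    rw [div_lt_one (by positivity)]; linarith
  refine ⟨(1 - (δ / (n + 1)) ^ 2) / n ^ n, ε, ?_, ?_, hε0, ?_, ?_⟩
  · have : 0 < 1 - (δ / (n + 1)) ^ 2 := by nlinarith
    positivity
  · gcongr
    nlinarith
  · rw [hε]
    gcongr
    linarith
  intro l hl hC k
  have hH : 0 < ∑ i, l i := Finset.sum_pos (fun i _ => hl i) ⟨k, Finset.mem_univ k⟩
  set H := ∑ i, l i with hHdef
  have hx : ∀ i, 0 < n * l i / H := fun i => by
    have := hl i
    positivity
  have hsum : ∑ i, n * l i / H = Fintype.card (Fin n) := by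
    rw [← Finset.sum_div, ← Finset.mul_sum, ← hHdef, Fintype.card_fin]
    field_simp
  have hprod : ∏ i, n * l i / H = n ^ n * ((∏ i, l i) / H ^ n) := by
    simp [Finset.prod_div_distrib, Finset.prod_mul_distrib, mul_div_assoc]
  have habs := abs_sub_one_le_of_le_prod hx hsum hδ0.le (by
    rw [hprod, Fintype.card_fin]
    rwa [div_le_iff₀' (by positivity)] at hC) k
  obtain ⟨x, hxdef⟩ : ∃ x, x = n * l k / H := ⟨_, rfl⟩
  rw [← hxdef] at habs
  have hxk : 1 / 2 ≤ x := by linarith [(abs_le.mp habs).1]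
  have hx0 : 0 < x := by linarith
  have hlk : l k = x * H / n := by rw [hxdef]; field_simp
  constructor
  · rw [hlk, hε]
    calc 1 / (2 * n) * H = 1 / 2 * H / n := by field_simp
      _ ≤ x * H / n := by gcongr
  · have hdiff : 1 / l k - n / H = n / (x * H) * -(x - 1) := by
      rw [hlk]; field_simp; ring
    rw [hdiff, abs_mul, abs_neg, abs_of_pos (by positivity)]
    calc n / (x * H) * |x - 1| ≤ n / (1 / 2 * H) * (ε ^ 2 / (16 * n * α)) := by
          gcongr
          exact habs.trans hδ
      _ = ε ^ 2 / (8 * α * H) := by field_simp; norm_num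
end
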